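/- The third Hochschild cohomology space HH³(U) of U = Diff(𝒜) has dimension at least 4 over k. -/

import Mathlib

/-!
Let `k` be a field of characteristic zero, `t ∈ k`, `t ≠ 0`, and let `U = Diff 𝒜` be the
algebra of differential operators tangent to the central arrangement `𝒜` of the three lines
`x = 0`, `y = 0`, `tx + y = 0` in `k²`, presented by generators `x, y, D, E` and relations
`[y,x] = 0`, `[D,x] = 0`, `[D,y] = y² + txy`, `[E,x] = x`, `[E,y] = y`, `[E,D] = D`.
Then the third Hochschild cohomology space `HH³(U)` has dimension at least `4` over `k`.
-/

open TensorProduct CategoryTheory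

/-- Relations presenting `Diff 𝒜`; the generators are `x = ι 0`, `y = ι 1`, `D = ι 2`,
`E = ι 3`. -/
inductive DiffRel (k : Type) [Field k] (t : k) :
    FreeAlgebra k (Fin 4) → FreeAlgebra k (Fin 4) → Prop
  | yx : DiffRel k t (FreeAlgebra.ι k 1 * FreeAlgebra.ι k 0)
      (FreeAlgebra.ι k 0 * FreeAlgebra.ι k 1)
  | Dx : DiffRel k t (FreeAlgebra.ι k 2 * FreeAlgebra.ι k 0)
      (FreeAlgebra.ι k 0 * FreeAlgebra.ι k 2)
  | Dy : DiffRel k t (FreeAlgebra.ι k 2 * FreeAlgebra.ι k 1)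
      (FreeAlgebra.ι k 1 * FreeAlgebra.ι k 2 +
        (FreeAlgebra.ι k 1 * FreeAlgebra.ι k 1 + t • (FreeAlgebra.ι k 0 * FreeAlgebra.ι k 1)))
  | Ex : DiffRel k t (FreeAlgebra.ι k 3 * FreeAlgebra.ι k 0)
      (FreeAlgebra.ι k 0 * FreeAlgebra.ι k 3 + FreeAlgebra.ι k 0)
  | Ey : DiffRel k t (FreeAlgebra.ι k 3 * FreeAlgebra.ι k 1)
      (FreeAlgebra.ι k 1 * FreeAlgebra.ι k 3 + FreeAlgebra.ι k 1)
  | ED : DiffRel k t (FreeAlgebra.ι k 3 * FreeAlgebra.ι k 2)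
      (FreeAlgebra.ι k 2 * FreeAlgebra.ι k 3 + FreeAlgebra.ι k 2)

/-- The algebra `Diff 𝒜` of differential operators tangent to a central arrangement of
three lines, as the quotient of the free algebra on `x, y, D, E` by the two-sided ideal
generated by the six relations. -/
abbrev DiffA (k : Type) [Field k] (t : k) : Type := RingQuot (DiffRel k t)

attribute [local instance] TensorProduct.Algebra.module

/-- The `n`-th Hochschild cohomology of a `k`-algebra `A` with coefficients in `A` itself, i.e.
`Ext^n` over the enveloping algebra `A ⊗[k] Aᵒᵖ` of `A` with itself. -/
noncomputable def HH (k : Type) [Field k] (A : Type) [Ring A] [Algebra k A] (n : ℕ) :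
    ModuleCat k :=
  ((Ext k (ModuleCat (A ⊗[k] Aᵐᵒᵖ)) n).obj
      (Opposite.op (ModuleCat.of (A ⊗[k] Aᵐᵒᵖ) A))).obj
    (ModuleCat.of (A ⊗[k] Aᵐᵒᵖ) A)


theorem rank_ge_of_cocycles {k : Type} [Field k] {R : Type} [Ring R] [Algebra k R]
    (X Y : ModuleCat.{0} R) (P : ProjectiveResolution X)
    (z : Fin 4 → (P.complex.X 3 ⟶ Y)) (hz : ∀ i, P.complex.d 4 3 ≫ z i = 0)
    (hind : ∀ (c : Fin 4 → k) (g : P.complex.X 2 ⟶ Y),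
      ∑ i, c i • z i = P.complex.d 3 2 ≫ g → c = 0) :
    4 ≤ Module.rank k (((Ext k (ModuleCat.{0} R) 3).obj (Opposite.op X)).obj Y) := by
  let K := P.complex.linearYonedaObj k Y
  let S := K.sc' 2 3 4
  let e1 : ((Ext k (ModuleCat.{0} R) 3).obj (Opposite.op X)).obj Y ≅ S.homology :=
    P.isoExt 3 Y ≪≫ K.homologyIsoSc' 2 3 4 (by simp) (by simp)
  let e2 := e1 ≪≫ S.moduleCatHomologyIso
  have e3 := e2.toLinearEquiv
  rw [e3.rank_eq]
  let zz : Fin 4 → LinearMap.ker S.g.hom := fun i => ⟨z i, hz i⟩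
  have hli : LinearIndependent k
      (fun i => Submodule.Quotient.mk (p := LinearMap.range S.moduleCatToCycles) (zz i)) := by
    rw [Fintype.linearIndependent_iff]
    intro c hc
    have : Submodule.Quotient.mk (p := LinearMap.range S.moduleCatToCycles) (∑ i, c i • zz i) = 0 := by
      rw [← hc]
      exact map_sum (Submodule.mkQ (LinearMap.range S.moduleCatToCycles)) _ _
    rw [Submodule.Quotient.mk_eq_zero] at this
    obtain ⟨g, hg⟩ := this
    have h2 := congrArg Subtype.val hg
    have := hind c g (by
      refine Eq.trans ?_ h2.symm
      rw [AddSubmonoidClass.coe_finsetSum]; rfl)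
    intro i; rw [this]; rfl
  have := hli.cardinal_le_rank
  simp only [Cardinal.mk_fin, Nat.cast_ofNat] at this
  exact this

theorem exists_lift' {R : Type} [Ring R] {Q M N K : Type} [AddCommGroup Q] [AddCommGroup M]
    [AddCommGroup N] [AddCommGroup K] [Module R Q] [Module R M] [Module R N] [Module R K]
    [Module.Projective R Q]
    {a : M →ₗ[R] N} {b : N →ₗ[R] K} (hab : Function.Exact a b) (q : Q →ₗ[R] N)
    (hq : b ∘ₗ q = 0) : ∃ h : Q →ₗ[R] M, a ∘ₗ h = q := by
  let q' : Q →ₗ[R] LinearMap.range a := q.codRestrict _ (fun c => (hab (q c)).1 (by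
    simpa using LinearMap.congr_fun hq c))
  obtain ⟨h, hh⟩ := Module.projective_lifting_property a.rangeRestrict q' a.surjective_rangeRestrict
  refine ⟨h, ?_⟩
  ext c
  exact congrArg Subtype.val (LinearMap.congr_fun hh c)

/-- Comparison of complexes. -/
theorem comparison {R : Type} [Ring R] {X Y P0 P1 P2 P3 P4 Q0 Q1 Q2 Q3 Q4 : Type}
    [AddCommGroup X] [AddCommGroup Y] [Module R X] [Module R Y]
    [AddCommGroup P0] [AddCommGroup P1] [AddCommGroup P2] [AddCommGroup P3] [AddCommGroup P4]
    [AddCommGroup Q0] [AddCommGroup Q1] [AddCommGroup Q2] [AddCommGroup Q3] [AddCommGroup Q4]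
    [Module R P0] [Module R P1] [Module R P2] [Module R P3] [Module R P4]
    [Module R Q0] [Module R Q1] [Module R Q2] [Module R Q3] [Module R Q4]
    [Module.Projective R P0] [Module.Projective R P1] [Module.Projective R P2]
    [Module.Projective R P3] [Module.Projective R P4]
    [Module.Projective R Q0] [Module.Projective R Q1] [Module.Projective R Q2]
    [Module.Projective R Q3]
    (εP : P0 →ₗ[R] X) (p1 : P1 →ₗ[R] P0) (p2 : P2 →ₗ[R] P1) (p3 : P3 →ₗ[R] P2) (p4 : P4 →ₗ[R] P3)
    (ε : Q0 →ₗ[R] X) (d1 : Q1 →ₗ[R] Q0) (d2 : Q2 →ₗ[R] Q1) (d3 : Q3 →ₗ[R] Q2) (d4 : Q4 →ₗ[R] Q3)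
    (hεP : Function.Surjective εP) (hp1 : Function.Exact p1 εP) (hp2 : Function.Exact p2 p1)
    (hp3 : Function.Exact p3 p2) (hp4 : Function.Exact p4 p3)
    (hε : Function.Surjective ε) (hd1 : Function.Exact d1 ε) (hd2 : Function.Exact d2 d1)
    (hd3 : Function.Exact d3 d2) (hd4 : Function.Exact d4 d3) :
    ∃ c3 : P3 →ₗ[R] Q3,
      (∀ f : Q3 →ₗ[R] Y, f ∘ₗ d4 = 0 → (f ∘ₗ c3) ∘ₗ p4 = 0) ∧
      (∀ f : Q3 →ₗ[R] Y, f ∘ₗ d4 = 0 → ∀ g : P2 →ₗ[R] Y, f ∘ₗ c3 = g ∘ₗ p3 →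
        ∃ g' : Q2 →ₗ[R] Y, f = g' ∘ₗ d3) := by
  have zP1 := hp1.linearMap_comp_eq_zero
  have zP2 := hp2.linearMap_comp_eq_zero
  have zP3 := hp3.linearMap_comp_eq_zero
  have zP4 := hp4.linearMap_comp_eq_zero
  have z1 := hd1.linearMap_comp_eq_zero
  have z2 := hd2.linearMap_comp_eq_zero
  have z3 := hd3.linearMap_comp_eq_zero
  have z4 := hd4.linearMap_comp_eq_zero
  obtain ⟨c0, hc0⟩ := Module.projective_lifting_property ε εP hε
  obtain ⟨c1, hc1⟩ := exists_lift' hd1 (c0 ∘ₗ p1) (by rw [← LinearMap.comp_assoc, hc0, zP1])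
  obtain ⟨c2, hc2⟩ := exists_lift' hd2 (c1 ∘ₗ p2) (by
    rw [← LinearMap.comp_assoc, hc1, LinearMap.comp_assoc, zP2, LinearMap.comp_zero])
  obtain ⟨c3, hc3⟩ := exists_lift' hd3 (c2 ∘ₗ p3) (by
    rw [← LinearMap.comp_assoc, hc2, LinearMap.comp_assoc, zP3, LinearMap.comp_zero])
  obtain ⟨c4, hc4⟩ := exists_lift' hd4 (c3 ∘ₗ p4) (by
    rw [← LinearMap.comp_assoc, hc3, LinearMap.comp_assoc, zP4, LinearMap.comp_zero])
  obtain ⟨q0, hq0⟩ := Module.projective_lifting_property εP ε hεP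
  obtain ⟨q1, hq1⟩ := exists_lift' hp1 (q0 ∘ₗ d1) (by rw [← LinearMap.comp_assoc, hq0, z1])
  obtain ⟨q2, hq2⟩ := exists_lift' hp2 (q1 ∘ₗ d2) (by
    rw [← LinearMap.comp_assoc, hq1, LinearMap.comp_assoc, z2, LinearMap.comp_zero])
  obtain ⟨q3, hq3⟩ := exists_lift' hp3 (q2 ∘ₗ d3) (by
    rw [← LinearMap.comp_assoc, hq2, LinearMap.comp_assoc, z3, LinearMap.comp_zero])
  simp only [LinearMap.ext_iff, LinearMap.comp_apply, LinearMap.zero_apply] at *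
  obtain ⟨h0, hh0⟩ := exists_lift' hd1 (LinearMap.id - c0 ∘ₗ q0) (by
    ext v; simp [hc0, hq0])
  simp only [LinearMap.ext_iff, LinearMap.comp_apply, LinearMap.sub_apply,
    LinearMap.id_apply] at hh0
  obtain ⟨h1, hh1⟩ := exists_lift' hd2 (LinearMap.id - c1 ∘ₗ q1 - h0 ∘ₗ d1) (by
    ext v; simp [hc1, hq1, hh0])
  simp only [LinearMap.ext_iff, LinearMap.comp_apply, LinearMap.sub_apply,
    LinearMap.id_apply] at hh1
  obtain ⟨h2, hh2⟩ := exists_lift' hd3 (LinearMap.id - c2 ∘ₗ q2 - h1 ∘ₗ d2) (by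
    ext v; simp [hc2, hq2, hh1, z2])
  simp only [LinearMap.ext_iff, LinearMap.comp_apply, LinearMap.sub_apply,
    LinearMap.id_apply] at hh2
  obtain ⟨h3, hh3⟩ := exists_lift' hd4 (LinearMap.id - c3 ∘ₗ q3 - h2 ∘ₗ d3) (by
    ext v; simp [hc3, hq3, hh2, z3])
  simp only [LinearMap.ext_iff, LinearMap.comp_apply, LinearMap.sub_apply,
    LinearMap.id_apply] at hh3
  refine ⟨c3, fun f hf v => by rw [← hc4, hf], fun f hf g hg => ⟨g ∘ₗ q2 + f ∘ₗ h2, fun v => ?_⟩⟩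
  have := congrArg f (hh3 v)
  rw [hf, map_sub, map_sub, hg, hq3] at this
  simp only [LinearMap.add_apply, LinearMap.comp_apply]
  rw [eq_comm, sub_sub, sub_eq_zero] at this
  exact this

theorem rank_ge_of_complex {k : Type} [Field k] {R : Type} [Ring R] [Algebra k R]
    {X Y Q0 Q1 Q2 Q3 Q4 : Type}
    [AddCommGroup X] [AddCommGroup Y] [Module R X] [Module R Y]
    [AddCommGroup Q0] [AddCommGroup Q1] [AddCommGroup Q2] [AddCommGroup Q3] [AddCommGroup Q4]
    [Module R Q0] [Module R Q1] [Module R Q2] [Module R Q3] [Module R Q4]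
    [Module.Projective R Q0] [Module.Projective R Q1] [Module.Projective R Q2]
    [Module.Projective R Q3]
    (ε : Q0 →ₗ[R] X) (d1 : Q1 →ₗ[R] Q0) (d2 : Q2 →ₗ[R] Q1) (d3 : Q3 →ₗ[R] Q2) (d4 : Q4 →ₗ[R] Q3)
    (hε : Function.Surjective ε) (hd1 : Function.Exact d1 ε) (hd2 : Function.Exact d2 d1)
    (hd3 : Function.Exact d3 d2) (hd4 : Function.Exact d4 d3)
    (f : Fin 4 → (Q3 →ₗ[R] Y)) (hf : ∀ i, f i ∘ₗ d4 = 0)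
    (hind : ∀ (c : Fin 4 → k) (g : Q2 →ₗ[R] Y),
      (∀ v, ∑ i, algebraMap k R (c i) • f i v = g (d3 v)) → c = 0) :
    4 ≤ Module.rank k (((Ext k (ModuleCat.{0} R) 3).obj
      (Opposite.op (ModuleCat.of R X))).obj (ModuleCat.of R Y)) := by
  let P := projectiveResolution (ModuleCat.of R X)
  have hproj : ∀ n, Module.Projective R (P.complex.X n) := fun n =>
    (IsProjective.iff_projective _).2 (inferInstanceAs (Projective (P.complex.X n)))
  have hex : ∀ n, Function.Exact (P.complex.d (n+2) (n+1)).hom (P.complex.d (n+1) n).hom := by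
    intro n
    exact (ShortComplex.ShortExact.moduleCat_exact_iff_function_exact _).1 (P.exact_succ n)
  obtain ⟨c3, h1, h2⟩ := comparison (Y := Y) (P.π.f 0).hom (P.complex.d 1 0).hom
    (P.complex.d 2 1).hom (P.complex.d 3 2).hom (P.complex.d 4 3).hom ε d1 d2 d3 d4
    ((ModuleCat.epi_iff_surjective _).1 inferInstance)
    ((ShortComplex.ShortExact.moduleCat_exact_iff_function_exact _).1 P.exact₀) (hex 0) (hex 1) (hex 2) hε hd1 hd2 hd3 hd4
  refine rank_ge_of_cocycles _ _ P (fun i => ModuleCat.ofHom (f i ∘ₗ c3)) (fun i => ?_) ?_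
  · ext v
    exact LinearMap.congr_fun (h1 _ (hf i)) v
  · intro c g hg
    let F : Q3 →ₗ[R] Y := (∑ i, c i • (ModuleCat.ofHom (f i) :
      ModuleCat.of R Q3 ⟶ ModuleCat.of R Y)).hom
    have hF : ∀ v, F v = ∑ i, algebraMap k R (c i) • f i v := by
      intro v
      simp only [F, ModuleCat.hom_sum, LinearMap.sum_apply]
      rfl
    have hF4 : F ∘ₗ d4 = 0 := by
      ext v
      simp only [LinearMap.comp_apply, hF, LinearMap.zero_apply]
      refine Finset.sum_eq_zero fun i _ => ?_
      have := LinearMap.congr_fun (hf i) v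
      simp only [LinearMap.comp_apply, LinearMap.zero_apply] at this
      rw [this, smul_zero]
    obtain ⟨g', hg'⟩ := h2 F hF4 g.hom (by
      rw [← ModuleCat.hom_comp, ← hg]
      ext v
      simp only [LinearMap.comp_apply, hF, ModuleCat.hom_sum, LinearMap.sum_apply]
      rfl)
    exact hind c g' fun v => by rw [← hF, hg']; rfl


/-- Elements of a ring which behave as the elements `z ⊗ 1 - 1 ⊗ z` of the enveloping algebra. -/
structure KData (R : Type) [Ring R] where
  (X Y D E A B : R)
  XY : X * Y = Y * X
  XD : X * D = D * X
  YD : Y * D = D * Y - A * Y - B * X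
  EX : E * X = X * E + X
  EY : E * Y = Y * E + Y
  ED : E * D = D * E + D
  EA : E * A = A * E + A
  EB : E * B = B * E + B
  AX : A * X = X * A
  AY : A * Y = Y * A
  BX : B * X = X * B
  BY : B * Y = Y * B
  S0 : ∀ r, r * X = 0 → r = 0
  S1 : ∀ r a, r * Y = a * X → ∃ b, r = b * X
  S2 : ∀ r a b, r * D = a * X + b * Y → ∃ a' b', r = a' * X + b' * Y
  S3 : ∀ r a b c, r * E = a * X + b * Y + c * D → ∃ a' b' c', r = a' * X + b' * Y + c' * D

namespace KData
variable {R : Type} [Ring R] (K : KData R)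

def d1 : (Fin 4 → R) →ₗ[R] R where
  toFun r := r 0 * K.X + r 1 * K.Y + r 2 * K.D + r 3 * K.E
  map_add' a b := by simp; noncomm_ring
  map_smul' a b := by simp; noncomm_ring

/-- Basis `xy, xD, yD, xE, yE, DE`. -/
def d2 : (Fin 6 → R) →ₗ[R] (Fin 4 → R) where
  toFun s := ![-s 0 * K.Y - s 1 * K.D + s 2 * K.B + s 3 * (1 - K.E),
    s 0 * K.X + s 2 * (K.A - K.D) + s 4 * (1 - K.E),
    s 1 * K.X + s 2 * K.Y + s 5 * (1 - K.E),
    s 3 * K.X + s 4 * K.Y + s 5 * K.D]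
  map_add' a b := by ext i; fin_cases i <;> simp <;> noncomm_ring
  map_smul' a b := by ext i; fin_cases i <;> simp <;> noncomm_ring

/-- Basis `xyD, xyE, xDE, yDE`. -/
def d3 : (Fin 4 → R) →ₗ[R] (Fin 6 → R) where
  toFun u := ![u 0 * (K.D - K.A) + u 1 * (K.E - 2),
    -u 0 * K.Y + u 2 * (K.E - 2),
    u 0 * K.X + u 3 * (K.E - 2),
    -u 1 * K.Y - u 2 * K.D + u 3 * K.B,
    u 1 * K.X + u 3 * (K.A - K.D),
    u 2 * K.X + u 3 * K.Y]
  map_add' a b := by ext i; fin_cases i <;> simp <;> noncomm_ring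
  map_smul' a b := by ext i; fin_cases i <;> simp <;> noncomm_ring

def d4 : R →ₗ[R] (Fin 4 → R) where
  toFun v := ![-v * (K.E - 3), v * (K.D - K.A), -v * K.Y, v * K.X]
  map_add' a b := by ext i; fin_cases i <;> simp <;> noncomm_ring
  map_smul' a b := by ext i; fin_cases i <;> simp <;> noncomm_ring

theorem d1_d2 (s) : K.d1 (K.d2 s) = 0 := by
  simp only [d1, d2, LinearMap.coe_mk, AddHom.coe_mk]
  simp
  linear_combination (norm := noncomm_ring) s 0 * K.XY + s 1 * K.XD + s 2 * K.YD - s 3 * K.EX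
    - s 4 * K.EY - s 5 * K.ED

theorem d2_d3 (u) : K.d2 (K.d3 u) = 0 := by
  simp only [d3, d2, LinearMap.coe_mk, AddHom.coe_mk]
  ext i; fin_cases i
  · simp
    linear_combination (norm := noncomm_ring) u 0 * K.YD - u 0 * K.BX - u 1 * K.EY - u 2 * K.ED
      + u 3 * K.EB
  · simp
    linear_combination (norm := noncomm_ring) - u 0 * K.AX - u 0 * K.XD + u 1 * K.EX + u 3 * K.EA
      - u 3 * K.ED
  · simp
    linear_combination (norm := noncomm_ring) u 0 * K.XY  + u 2 * K.EX + u 3 * K.EY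
  · simp
    linear_combination (norm := noncomm_ring) u 1 * K.XY + u 2 * K.XD + u 3 * K.YD

theorem d3_d4 (v) : K.d3 (K.d4 v) = 0 := by
  simp only [d3, d4, LinearMap.coe_mk, AddHom.coe_mk]
  ext i; fin_cases i
  · simp
    linear_combination (norm := noncomm_ring) -v * K.ED + v * K.EA
  · simp
    linear_combination (norm := noncomm_ring) v * K.EY
  · simp
    linear_combination (norm := noncomm_ring) - v * K.EX
  · simp
    linear_combination (norm := noncomm_ring) v * K.YD - v * K.BX
  · simp
    linear_combination (norm := noncomm_ring) - v * K.XD - v * K.AX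
  · simp
    linear_combination (norm := noncomm_ring) v * K.XY

theorem lemA (r s : R) (h : r * K.X + s * K.Y = 0) : ∃ u, r = -u * K.Y ∧ s = u * K.X := by
  obtain ⟨u, rfl⟩ := K.S1 s (-r) (by linear_combination (norm := noncomm_ring) h)
  refine ⟨u, ?_, rfl⟩
  have := K.S0 (r + u * K.Y) (by linear_combination (norm := noncomm_ring) h - u * K.XY)
  linear_combination (norm := noncomm_ring) this

theorem lemB1 (r s q : R) (h : r * K.X + s * K.Y + q * K.D = 0) : ∃ a b c,
    r = -a * K.Y - b * K.D + c * K.B ∧ s = a * K.X + c * (K.A - K.D) ∧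
    q = b * K.X + c * K.Y := by
  obtain ⟨b, c, rfl⟩ := K.S2 q (-r) (-s) (by linear_combination (norm := noncomm_ring) h)
  obtain ⟨a, h1, h2⟩ := K.lemA (r + b * K.D - c * K.B) (s - c * (K.A - K.D)) (by
    linear_combination (norm := noncomm_ring) h - b * K.XD - c * K.YD)
  refine ⟨a, b, c, ?_, ?_, rfl⟩
  · linear_combination (norm := noncomm_ring) h1
  · linear_combination (norm := noncomm_ring) h2

theorem lemB2 (a b c : R) (h2 : a * K.X + c * (K.A - K.D) = 0)
    (h3 : b * K.X + c * K.Y = 0) :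
    ∃ u, a = u * (K.D - K.A) ∧ b = -u * K.Y ∧ c = u * K.X := by
  obtain ⟨u, rfl, rfl⟩ := K.lemA _ _ h3
  refine ⟨u, ?_, rfl, rfl⟩
  have := K.S0 (a - u * (K.D - K.A)) (by
    linear_combination (norm := noncomm_ring) h2 + u * K.XD + u * K.AX)
  linear_combination (norm := noncomm_ring) this

theorem exact1 : Function.Exact K.d2 K.d1 := by
  intro r
  constructor
  · intro h
    obtain ⟨a, b, c, h3⟩ := K.S3 (r 3) (-r 0) (-r 1) (-r 2) (by
      simp only [d1, LinearMap.coe_mk, AddHom.coe_mk] at h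
      linear_combination (norm := noncomm_ring) h)
    have h' : K.d1 (r - K.d2 ![0, 0, 0, a, b, c]) = 0 := by rw [map_sub, d1_d2, h, sub_zero]
    obtain ⟨p, q, s, h0, h1, h2⟩ := K.lemB1 (r 0 - a * (1 - K.E)) (r 1 - b * (1 - K.E))
      (r 2 - c * (1 - K.E)) (by
        simp only [d1, d2, LinearMap.coe_mk, AddHom.coe_mk] at h'
        simp at h'
        linear_combination (norm := noncomm_ring) h' - h3 * K.E)
    refine ⟨![p, q, s, a, b, c], ?_⟩
    simp only [d2, LinearMap.coe_mk, AddHom.coe_mk]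
    ext i; fin_cases i
    · simp
      linear_combination (norm := noncomm_ring) -h0
    · simp
      linear_combination (norm := noncomm_ring) -h1
    · simp
      linear_combination (norm := noncomm_ring) -h2
    · simp
      linear_combination (norm := noncomm_ring) -h3
  · rintro ⟨s, rfl⟩; exact K.d1_d2 s

theorem exact2 : Function.Exact K.d3 K.d2 := by
  intro s
  constructor
  · intro h
    have hE := congrFun h 3
    simp [d2] at hE
    obtain ⟨p, q, w, h3, h4, h5⟩ := K.lemB1 _ _ _ hE
    have h' : K.d2 (s - K.d3 ![0, p, q, w]) = 0 := by rw [map_sub, d2_d3, h, sub_zero]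
    have hy := congrFun h' 1
    have hz := congrFun h' 2
    simp [-Matrix.sub_cons, d2, d3, h4, h5] at hy hz
    obtain ⟨u, h0, h1, h2⟩ := K.lemB2 (s 0 - p * (K.E - 2)) (s 1 - q * (K.E - 2))
      (s 2 - w * (K.E - 2)) hy hz
    refine ⟨![u, p, q, w], ?_⟩
    simp only [d3, LinearMap.coe_mk, AddHom.coe_mk]
    ext i; fin_cases i
    · simp
      linear_combination (norm := noncomm_ring) -h0
    · simp
      linear_combination (norm := noncomm_ring) -h1
    · simp
      linear_combination (norm := noncomm_ring) -h2
    · simp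
      linear_combination (norm := noncomm_ring) -h3
    · simp
      linear_combination (norm := noncomm_ring) -h4
    · simp
      linear_combination (norm := noncomm_ring) -h5
  · rintro ⟨s, rfl⟩; exact K.d2_d3 s

theorem exact3 : Function.Exact K.d4 K.d3 := by
  intro u
  constructor
  · intro h
    have hy := congrFun h 4
    have hz := congrFun h 5
    simp [d3] at hy hz
    obtain ⟨v, h1, h2, h3⟩ := K.lemB2 _ _ _ hy hz
    have h' : K.d3 (u - K.d4 v) = 0 := by rw [map_sub, d3_d4, h, sub_zero]
    have hw := congrFun h' 2
    simp [-Matrix.sub_cons, d3, d4, h3] at hw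
    have h0 := K.S0 (u 0 + v * (K.E - 3)) (by linear_combination (norm := noncomm_ring) hw)
    refine ⟨v, ?_⟩
    simp only [d4, LinearMap.coe_mk, AddHom.coe_mk]
    ext i; fin_cases i
    · simp
      linear_combination (norm := noncomm_ring) -h0
    · simp [h1]
    · simp [h2]
    · simp [h3]
  · rintro ⟨s, rfl⟩; exact K.d3_d4 s


def I4 : Submodule R R := LinearMap.range K.d1
theorem X_mem : K.X ∈ K.I4 := ⟨Pi.single 0 1, by simp [d1]⟩
theorem Y_mem : K.Y ∈ K.I4 := ⟨Pi.single 1 1, by simp [d1]⟩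
theorem D_mem : K.D ∈ K.I4 := ⟨Pi.single 2 1, by simp [d1]⟩
theorem E_mem : K.E ∈ K.I4 := ⟨Pi.single 3 1, by simp [d1]⟩

theorem rank_ge {k : Type} [Field k] [Algebra k R] {U : Type} [AddCommGroup U] [Module R U]
    (ε : R →ₗ[R] U) (hs : Function.Surjective ε) (hk : ∀ r, ε r = 0 → r ∈ K.I4)
    (hX : ε K.X = 0) (hY : ε K.Y = 0) (hD : ε K.D = 0) (hE : ε K.E = 0)
    (c a b : Fin 4 → U)
    (hcoc : ∀ i, K.X • b i - K.Y • a i + (K.D - K.A) • c i = 0)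
    (hind : ∀ (e : Fin 4 → k) (gxy gxD gyD qx qy p : U),
      ∑ i, algebraMap k R (e i) • c i = K.X • qy - K.Y • qx + (K.E - 2) • gxy →
      ∑ i, algebraMap k R (e i) • a i = K.X • p - K.D • qx + (K.E - 2) • gxD →
      ∑ i, algebraMap k R (e i) • b i =
        K.Y • p + (K.A - K.D) • qy + K.B • qx + (K.E - 2) • gyD → e = 0) :
    4 ≤ Module.rank k (((Ext k (ModuleCat.{0} R) 3).obj
      (Opposite.op (ModuleCat.of R U))).obj (ModuleCat.of R U)) := by
  have hex : Function.Exact K.d1 ε := by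
    intro r
    refine ⟨fun h => hk r h, ?_⟩
    rintro ⟨s, rfl⟩
    have hm : ∀ x y : R, ε (x * y) = x • ε y := fun x y => ε.map_smul x y
    simp [d1, hm, hX, hY, hD, hE]
  let f : Fin 4 → ((Fin 4 → R) →ₗ[R] U) := fun i =>
    { toFun := fun u => u 1 • c i + u 2 • a i + u 3 • b i
      map_add' := fun u v => by simp only [Pi.add_apply, add_smul]; abel
      map_smul' := fun r u => by simp [mul_smul] }
  refine rank_ge_of_complex ε K.d1 K.d2 K.d3 K.d4 hs hex K.exact1 K.exact2 K.exact3 f ?_ ?_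
  · intro i
    refine LinearMap.ext fun v => ?_
    have h := congrArg (fun z => v • z) (hcoc i)
    simp only [smul_zero, smul_add, smul_sub, ← mul_smul] at h
    simp [f, d4]
    rw [← h]; abel
  · intro e g h
    have key : ∀ z : Fin 6 → R, g z = z 0 • g (Pi.single 0 1) + z 1 • g (Pi.single 1 1) +
        z 2 • g (Pi.single 2 1) + z 3 • g (Pi.single 3 1) + z 4 • g (Pi.single 4 1) +
        z 5 • g (Pi.single 5 1) := by
      intro z
      have : z = z 0 • Pi.single 0 1 + z 1 • Pi.single 1 1 +
        z 2 • Pi.single 2 1 + z 3 • Pi.single 3 1 + z 4 • Pi.single 4 1 +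
        z 5 • Pi.single 5 1 := by
        ext i; fin_cases i <;> simp
      conv_lhs => rw [this]
      simp only [map_add, map_smul]
    refine hind e (g (Pi.single 0 1)) (g (Pi.single 1 1)) (g (Pi.single 2 1))
      (g (Pi.single 3 1)) (g (Pi.single 4 1)) (g (Pi.single 5 1)) ?_ ?_ ?_
    · have h1 := h (Pi.single 1 1)
      rw [key] at h1
      simp [f, d3] at h1
      rw [h1]; abel
    · have h1 := h (Pi.single 2 1)
      rw [key] at h1
      simp [f, d3] at h1
      rw [h1]; abel
    · have h1 := h (Pi.single 3 1)
      rw [key] at h1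
      simp [f, d3] at h1
      rw [h1]; abel

end KData

namespace DA
variable {k : Type} [Field k] {t : k}

noncomputable def gen (t : k) (i : Fin 4) : DiffA k t :=
  RingQuot.mkAlgHom k (DiffRel k t) (FreeAlgebra.ι k i)

theorem mk_eq {a b : FreeAlgebra k (Fin 4)} (h : DiffRel k t a b) :
    RingQuot.mkAlgHom k (DiffRel k t) a = RingQuot.mkAlgHom k (DiffRel k t) b :=
  RingQuot.mkAlgHom_rel k h

theorem yx : gen t 1 * gen t 0 = gen t 0 * gen t 1 := by
  simpa [gen] using mk_eq (DiffRel.yx (k := k) (t := t))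
theorem Dx : gen t 2 * gen t 0 = gen t 0 * gen t 2 := by
  simpa [gen] using mk_eq (DiffRel.Dx (k := k) (t := t))
theorem Dy : gen t 2 * gen t 1 =
    gen t 1 * gen t 2 + (gen t 1 * gen t 1 + t • (gen t 0 * gen t 1)) := by
  simpa [gen] using mk_eq (DiffRel.Dy (k := k) (t := t))
theorem Ex : gen t 3 * gen t 0 = gen t 0 * gen t 3 + gen t 0 := by
  simpa [gen] using mk_eq (DiffRel.Ex (k := k) (t := t))
theorem Ey : gen t 3 * gen t 1 = gen t 1 * gen t 3 + gen t 1 := by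
  simpa [gen] using mk_eq (DiffRel.Ey (k := k) (t := t))
theorem ED : gen t 3 * gen t 2 = gen t 2 * gen t 3 + gen t 2 := by
  simpa [gen] using mk_eq (DiffRel.ED (k := k) (t := t))

theorem induct {p : DiffA k t → Prop} (h1 : p 1) (hadd : ∀ u v, p u → p v → p (u + v))
    (hsmul : ∀ (c : k) u, p u → p (c • u)) (hg : ∀ i u, p u → p (gen t i * u)) (u : DiffA k t) :
    p u := by
  obtain ⟨a, rfl⟩ := RingQuot.mkAlgHom_surjective k (DiffRel k t) u
  suffices h : ∀ w, p w → p (RingQuot.mkAlgHom k (DiffRel k t) a * w) by simpa using h 1 h1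
  induction a using FreeAlgebra.induction with
  | grade0 r => intro w hw; simpa [Algebra.algebraMap_eq_smul_one] using hsmul r w hw
  | grade1 i => intro w hw; exact hg i w hw
  | mul a b ha hb => intro w hw; rw [map_mul, mul_assoc]; exact ha _ (hb _ hw)
  | add a b ha hb => intro w hw; rw [map_add, add_mul]; exact hadd _ _ (ha _ hw) (hb _ hw)

open MvPolynomial

abbrev V (k : Type) [Field k] := MvPolynomial (Fin 4) k

theorem pcomm (i j : Fin 4) (v : V k) : pderiv i (pderiv j v) = pderiv j (pderiv i v) := by
  have : ⁅(pderiv i : Derivation k (V k) (V k)), (pderiv j : Derivation k (V k) (V k))⁆ = 0 := by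
    apply MvPolynomial.derivation_ext
    intro l
    rw [Derivation.commutator_apply]
    simp [pderiv_X, Pi.single_apply]
    split_ifs <;> simp
  have h := congrArg (fun d => d v) this
  rw [Derivation.commutator_apply] at h
  simpa [sub_eq_zero] using h

noncomputable def op (t : k) : Fin 4 → Module.End k (V k) :=
  ![LinearMap.mulLeft k (X 0), LinearMap.mulLeft k (X 1),
    LinearMap.mulLeft k (X 2) +
      LinearMap.mulLeft k ((X 1 + C t * X 0) * X 1) ∘ₗ (pderiv 1).toLinearMap,
    LinearMap.mulLeft k (X 3) + LinearMap.mulLeft k (X 0) ∘ₗ (pderiv 0).toLinearMap +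
      LinearMap.mulLeft k (X 1) ∘ₗ (pderiv 1).toLinearMap +
      LinearMap.mulLeft k (X 2) ∘ₗ (pderiv 2).toLinearMap]

theorem op0 (v : V k) : op t 0 v = X 0 * v := rfl
theorem op1 (v : V k) : op t 1 v = X 1 * v := rfl
theorem op2 (v : V k) : op t 2 v = X 2 * v + (X 1 + C t * X 0) * X 1 * pderiv 1 v := rfl
theorem op3 (v : V k) : op t 3 v = X 3 * v + X 0 * pderiv 0 v + X 1 * pderiv 1 v
    + X 2 * pderiv 2 v := rfl

noncomputable def rep (t : k) : DiffA k t →ₐ[k] Module.End k (V k) :=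
  RingQuot.liftAlgHom k ⟨FreeAlgebra.lift k (op t), by
    intro a b h
    induction h <;> simp only [map_mul, map_add, map_smul, FreeAlgebra.lift_ι_apply] <;>
      refine LinearMap.ext fun v => ?_ <;>
      simp only [Module.End.mul_apply, LinearMap.add_apply, LinearMap.smul_apply, op0, op1, op2,
        op3, smul_eq_C_mul]
    · ring
    · simp; ring
    · simp; ring
    · simp; ring
    · simp; ring
    · simp [pcomm 1 0 v, pcomm 1 2 v]; ring⟩

theorem rep_gen (i : Fin 4) : rep t (gen t i) = op t i := by
  simp [rep, gen]


/-- An algebra with the defining properties of `Diff 𝒜` we use. -/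
structure Dat (k : Type) [Field k] (t : k) (U : Type) [Ring U] [Algebra k U] where
  g : Fin 4 → U
  yx : g 1 * g 0 = g 0 * g 1
  Dx : g 2 * g 0 = g 0 * g 2
  Dy : g 2 * g 1 = g 1 * g 2 + (g 1 * g 1 + t • (g 0 * g 1))
  Ex : g 3 * g 0 = g 0 * g 3 + g 0
  Ey : g 3 * g 1 = g 1 * g 3 + g 1
  ED : g 3 * g 2 = g 2 * g 3 + g 2
  induct : ∀ (p : U → Prop), p 1 → (∀ u v, p u → p v → p (u + v)) →
    (∀ (c : k) u, p u → p (c • u)) → (∀ i u, p u → p (g i * u)) → ∀ u, p u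
  rep : U →ₐ[k] Module.End k (V k)
  rep_gen : ∀ i, rep (g i) = op t i

noncomputable def dat (t : k) : Dat k t (DiffA k t) where
  g := gen t
  yx := yx
  Dx := Dx
  Dy := Dy
  Ex := Ex
  Ey := Ey
  ED := ED
  induct p h1 h2 h3 h4 u := induct h1 h2 h3 h4 u
  rep := rep t
  rep_gen := rep_gen

end DA

namespace DA
open MvPolynomial
variable {k : Type} [Field k] {t : k}

abbrev Ix := Fin 4 →₀ ℕ
noncomputable abbrev ee (i : Fin 4) : Ix := Finsupp.single i 1
noncomputable abbrev mo (k : Type) [Field k] (m : Ix) : V k := monomial m 1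

theorem X_mo (i : Fin 4) (m : Ix) : X i * mo k m = mo k (m + ee i) := by
  rw [mul_comm, X, monomial_mul, one_mul]

theorem Xp_mo (i : Fin 4) (m : Ix) : X i * pderiv i (mo k m) = (m i : k) • mo k m := by
  rw [X_mul_pderiv_monomial, Nat.cast_smul_eq_nsmul]

theorem op0_mo (m : Ix) : op t 0 (mo k m) = mo k (m + ee 0) := X_mo _ _
theorem op1_mo (m : Ix) : op t 1 (mo k m) = mo k (m + ee 1) := X_mo _ _
theorem op2_mo (m : Ix) : op t 2 (mo k m) = mo k (m + ee 2) +
    (m 1 : k) • (mo k (m + ee 1) + t • mo k (m + ee 0)) := by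
  rw [op2, X_mo, mul_assoc, Xp_mo, ← X_mo 1, ← X_mo 0]
  simp only [smul_eq_C_mul]; ring
theorem op3_mo (m : Ix) : op t 3 (mo k m) = mo k (m + ee 3) +
    ((m 0 : k) + (m 1 : k) + (m 2 : k)) • mo k m := by
  rw [op3, X_mo, Xp_mo, Xp_mo, Xp_mo]
  simp only [smul_eq_C_mul, map_add]; ring


variable {U : Type} [Ring U] [Algebra k U] (H : Dat k t U)

noncomputable def lam : U →ₗ[k] V k :=
  LinearMap.applyₗ (1 : V k) ∘ₗ H.rep.toLinearMap

theorem lam_apply (u : U) : lam H u = H.rep u 1 := rfl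

theorem lam_gen_mul (i : Fin 4) (u : U) : lam H (H.g i * u) = op t i (lam H u) := by
  simp [lam_apply, H.rep_gen]

theorem lam_one : lam H 1 = 1 := by simp [lam_apply]

theorem y_xpow (a : ℕ) : H.g 1 * H.g 0 ^ a = H.g 0 ^ a * H.g 1 :=
  (Commute.pow_right (H.yx : Commute (H.g 1) (H.g 0)) a)
theorem D_xpow (a : ℕ) : H.g 2 * H.g 0 ^ a = H.g 0 ^ a * H.g 2 :=
  (Commute.pow_right (H.Dx : Commute (H.g 2) (H.g 0)) a)

theorem E_pow {z : U} (h : H.g 3 * z = z * H.g 3 + z) (a : ℕ) :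
    H.g 3 * z ^ a = z ^ a * H.g 3 + (a : k) • z ^ a := by
  induction a with
  | zero => simp
  | succ a ih =>
    rw [pow_succ, ← mul_assoc, ih, add_mul, mul_assoc, h]
    simp only [mul_add, smul_mul_assoc, Nat.cast_add, Nat.cast_one, add_smul, one_smul, mul_assoc]
    abel

theorem D_ypow (b : ℕ) : H.g 2 * H.g 1 ^ b = H.g 1 ^ b * H.g 2 +
    (b : k) • (H.g 1 ^ (b + 1) + t • (H.g 0 * H.g 1 ^ b)) := by
  induction b with
  | zero => simp
  | succ a ih =>
    rw [pow_succ, ← mul_assoc, ih, add_mul, mul_assoc, H.Dy]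
    simp only [mul_add, smul_mul_assoc, Nat.cast_add, Nat.cast_one, add_smul, one_smul, mul_assoc,
      add_mul, pow_succ, smul_add, mul_smul_comm]
    have h : H.g 1 ^ a * (H.g 0 * H.g 1) = H.g 0 * (H.g 1 ^ a * H.g 1) := by
      rw [← mul_assoc, ← mul_assoc]
      rw [((Commute.pow_right (H.yx : Commute (H.g 1) (H.g 0)).symm a)).eq]
    rw [h]
    abel

/-- Product of powers of the generators of index `< i`. -/
noncomputable def lo (i : Fin 4) (m : Ix) : U :=
  ![1, H.g 0 ^ m 0, H.g 0 ^ m 0 * H.g 1 ^ m 1,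
    H.g 0 ^ m 0 * H.g 1 ^ m 1 * H.g 2 ^ m 2] i

/-- Ordered monomial. -/
noncomputable def pbw (m : Ix) : U :=
  H.g 0 ^ m 0 * H.g 1 ^ m 1 * H.g 2 ^ m 2 * H.g 3 ^ m 3

noncomputable def hi (i : Fin 4) (m : Ix) : Ix := m.filter (fun j => i ≤ j)

theorem lo_mul_hi (i : Fin 4) (m : Ix) : lo H i m * pbw H (hi i m) = pbw H m := by
  fin_cases i <;> simp [lo, pbw, hi, Finsupp.filter_apply, mul_assoc]

theorem hi_add_lt {i j : Fin 4} (h : j < i) (m : Ix) : hi i (m + ee j) = hi i m := by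
  rw [hi, Finsupp.filter_add, Finsupp.filter_single_of_neg _ (by simpa using h), add_zero, hi]
theorem hi_add_ge {i j : Fin 4} (h : i ≤ j) (m : Ix) : hi i (m + ee j) = hi i m + ee j := by
  rw [hi, Finsupp.filter_add, Finsupp.filter_single_of_pos _ (by simpa using h), hi]

noncomputable def mon : V k →ₗ[k] U :=
  (basisMonomials (Fin 4) k).constr k (pbw H)

theorem mon_mo (m : Ix) : mon H (mo k m) = pbw H m := by
  have := (basisMonomials (Fin 4) k).constr_basis k (pbw H) m
  simpa [mon] using this

theorem V_ext {M : Type} [AddCommMonoid M] [Module k M] {f g : V k →ₗ[k] M}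
    (h : ∀ m, f (mo k m) = g (mo k m)) (v : V k) : f v = g v := by
  have : f = g := (basisMonomials (Fin 4) k).ext (by simpa using h)
  rw [this]

theorem lo1_0 (m : Ix) : H.g 0 * lo H 1 m = lo H 1 (m + ee 0) := by
  simp [lo, pow_succ']
theorem lo2_0 (m : Ix) : H.g 0 * lo H 2 m = lo H 2 (m + ee 0) := by
  simp [lo, pow_succ', mul_assoc]
theorem lo3_0 (m : Ix) : H.g 0 * lo H 3 m = lo H 3 (m + ee 0) := by
  simp [lo, pow_succ', mul_assoc]
theorem lo2_1 (m : Ix) : H.g 1 * lo H 2 m = lo H 2 (m + ee 1) := by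
  simp [lo, ← mul_assoc, y_xpow]; simp [mul_assoc, pow_succ']
theorem lo3_1 (m : Ix) : H.g 1 * lo H 3 m = lo H 3 (m + ee 1) := by
  simp [lo, ← mul_assoc, y_xpow]; simp [mul_assoc, pow_succ']
theorem D_lo2 (m : Ix) : H.g 2 * lo H 2 m = lo H 2 m * H.g 2 +
    (m 1 : k) • (lo H 2 (m + ee 1) + t • lo H 2 (m + ee 0)) := by
  simp [lo, ← mul_assoc, D_xpow]
  rw [mul_assoc, D_ypow]
  simp [mul_add, mul_assoc, pow_succ]
theorem D_lo3 (m : Ix) : H.g 2 * lo H 3 m = lo H 3 (m + ee 2) +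
    (m 1 : k) • (lo H 3 (m + ee 1) + t • lo H 3 (m + ee 0)) := by
  have h := congrArg (· * H.g 2 ^ m 2) (D_lo2 H m)
  simp [lo, add_mul, mul_assoc] at h
  simp [lo, h, mul_assoc, pow_succ', add_mul]
theorem E_lo3 (m : Ix) : H.g 3 * lo H 3 m = lo H 3 m * H.g 3 +
    ((m 0 : k) + (m 1 : k) + (m 2 : k)) • lo H 3 m := by
  simp [lo]
  rw [← mul_assoc, ← mul_assoc, E_pow H H.Ex, add_mul, mul_assoc _ (H.g 3), E_pow H H.Ey, add_mul, mul_add,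
    add_mul]
  rw [← mul_assoc, mul_assoc _ (H.g 3), E_pow H H.ED]
  simp only [mul_add, mul_assoc, add_smul, smul_mul_assoc, mul_smul_comm]
  abel
theorem E_lo2 (m : Ix) : H.g 3 * lo H 2 m = lo H 2 m * H.g 3 +
    ((m 0 : k) + (m 1 : k)) • lo H 2 m := by
  have h := E_lo3 H (m - Finsupp.single 2 (m 2))
  simpa [lo] using h

theorem pbw_lo (m : Ix) : pbw H m = lo H 3 m * H.g 3 ^ m 3 := rfl

theorem mon_op (i : Fin 4) (v : V k) : mon H (op t i v) = H.g i * mon H v := by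
  refine V_ext (f := mon H ∘ₗ op t i) (g := LinearMap.mulLeft k (H.g i) ∘ₗ mon H) (fun m => ?_) v
  simp only [LinearMap.comp_apply, LinearMap.mulLeft_apply, mon_mo]
  rw [pbw_lo, ← mul_assoc]
  fin_cases i
  · simp [op0_mo, mon_mo, pbw_lo, lo3_0]
  · simp [op1_mo, mon_mo, pbw_lo, lo3_1]
  · simp [op2_mo, mon_mo, pbw_lo, D_lo3, add_mul]
  · simp [op3_mo, mon_mo, pbw_lo, E_lo3, add_mul, pow_succ', mul_assoc]
    simp [lo]

theorem mon_lam (u : U) : mon H (lam H u) = u := by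
  refine H.induct (fun u => mon H (lam H u) = u) ?_ ?_ ?_ ?_ u
  · rw [lam_one, show (1 : V k) = mo k 0 from rfl, mon_mo]; simp [pbw]
  · intro u v hu hv; rw [map_add, map_add, hu, hv]
  · intro c u hu; rw [map_smul, map_smul, hu]
  · intro i u hu; rw [lam_gen_mul, mon_op, hu]

abbrev T (_ : Dat k t U) := Ix →₀ U

noncomputable def kap (i : Fin 4) : V k →ₗ[k] T H :=
  (basisMonomials (Fin 4) k).constr k (fun m => Finsupp.single (hi i m) (lo H i m))

theorem kap_mo (i : Fin 4) (m : Ix) :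
    kap H i (mo k m) = Finsupp.single (hi i m) (lo H i m) := by
  have := (basisMonomials (Fin 4) k).constr_basis k
    (fun m => (Finsupp.single (hi i m) (lo H i m) : T H)) m
  simpa [kap] using this

theorem kap_lt {i j : Fin 4} (h : j < i) (v : V k) : kap H i (op t j v) = H.g j • kap H i v := by
  refine V_ext (f := kap H i ∘ₗ op t j)
    (g := DistribSMul.toLinearMap k (T H) (H.g j) ∘ₗ kap H i) (fun m => ?_) v
  simp only [LinearMap.comp_apply, DistribSMul.toLinearMap_apply, kap_mo]
  have h2 := hi_add_lt h m
  fin_cases j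
  · have h0 : hi i (m + ee 0) = hi i m := h2
    simp only [Fin.zero_eta, op0_mo, kap_mo, h0, Finsupp.smul_single, smul_eq_mul]
    fin_cases i
    · simp at h
    · exact congrArg _ (lo1_0 H m).symm
    · exact congrArg _ (lo2_0 H m).symm
    · exact congrArg _ (lo3_0 H m).symm
  · have h0 : hi i (m + ee 1) = hi i m := h2
    simp only [Fin.mk_one, op1_mo, kap_mo, h0, Finsupp.smul_single, smul_eq_mul]
    fin_cases i
    · simp at h
    · simp at h
    · exact congrArg _ (lo2_1 H m).symm
    · exact congrArg _ (lo3_1 H m).symm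
  · have hi3 : i = 3 := by change (2 : Fin 4) < i at h; omega
    subst hi3
    have h0 : hi 3 (m + ee 0) = hi 3 m := hi_add_lt (by decide) m
    have h1 : hi 3 (m + ee 1) = hi 3 m := hi_add_lt (by decide) m
    have h2 : hi 3 (m + ee 2) = hi 3 m := hi_add_lt (by decide) m
    simp only [Fin.reduceFinMk, op2_mo, kap_mo, map_add, map_smul, h0, h1, h2,
      Finsupp.smul_single, ← Finsupp.single_add, smul_eq_mul, D_lo3]
  · change (3 : Fin 4) < i at h; omega

noncomputable def rmul (g : U) : T H →ₗ[k] T H :=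
  Finsupp.mapRange.linearMap (LinearMap.mulRight k g)
noncomputable def shift (i : Fin 4) : T H →ₗ[k] T H :=
  Finsupp.lmapDomain (U) k (fun m => m + ee i)

theorem rmul_apply (g : U) (f : T H) (m : Ix) : rmul H g f m = f m * g := by
  simp [rmul]
theorem rmul_single (g u : U) (m : Ix) :
    rmul H g (Finsupp.single m u) = Finsupp.single m (u * g) := by
  simp [rmul]
theorem shift_single (i : Fin 4) (u : U) (m : Ix) :
    shift H i (Finsupp.single m u) = Finsupp.single (m + ee i) u := by
  simp [shift]
theorem rmul_smul (g u : U) (f : T H) : rmul H g (u • f) = u • rmul H g f := by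
  ext m; simp [rmul_apply, mul_assoc]
theorem shift_smul (i : Fin 4) (u : U) (f : T H) : shift H i (u • f) = u • shift H i f := by
  simp [shift, Finsupp.lmapDomain_apply, Finsupp.mapDomain_smul]

theorem kap_eq (i : Fin 4) (v : V k) : kap H i (op t i v) + rmul H (H.g i) (kap H i v) =
    H.g i • kap H i v + shift H i (kap H i v) := by
  refine V_ext (f := kap H i ∘ₗ op t i + rmul H (H.g i) ∘ₗ kap H i)
    (g := DistribSMul.toLinearMap k (T H) (H.g i) ∘ₗ kap H i + shift H i ∘ₗ kap H i)
    (fun m => ?_) v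
  simp only [LinearMap.comp_apply, DistribSMul.toLinearMap_apply, kap_mo, LinearMap.add_apply,
    rmul_single, shift_single, Finsupp.smul_single, smul_eq_mul]
  have hh := hi_add_ge (le_refl i) m
  fin_cases i
  · simp only [Fin.zero_eta, op0_mo, kap_mo]
    rw [show hi 0 (m + ee 0) = hi 0 m + ee 0 from hh]
    simp [lo, add_comm]
  · simp only [Fin.mk_one, op1_mo, kap_mo]
    rw [show hi 1 (m + ee 1) = hi 1 m + ee 1 from hh]
    simp [lo, y_xpow, add_comm]
  · have h0 : hi 2 (m + ee 0) = hi 2 m := hi_add_lt (by decide) m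
    have h1 : hi 2 (m + ee 1) = hi 2 m := hi_add_lt (by decide) m
    simp only [Fin.reduceFinMk, op2_mo, kap_mo, map_add, map_smul, D_lo2, h0, h1,
      Finsupp.single_add, Finsupp.smul_single, ← Finsupp.smul_single]
    rw [show hi 2 (m + ee 2) = hi 2 m + ee 2 from hh]
    rw [show lo H 2 (m + ee 2) = lo H 2 m by simp [lo]]
    abel
  · simp only [Fin.reduceFinMk, op3_mo, kap_mo, map_add, map_smul, E_lo3,
      Finsupp.single_add, Finsupp.smul_single, ← Finsupp.smul_single]
    rw [show hi 3 (m + ee 3) = hi 3 m + ee 3 from hh]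
    rw [show lo H 3 (m + ee 3) = lo H 3 m by simp [lo]]
    abel

theorem Phi_inj (i : Fin 4) (f : T H) (h : rmul H (H.g i) f = shift H i f) : f = 0 := by
  by_contra hf
  obtain ⟨n, hn, hmax⟩ := Finset.exists_max_image f.support (fun n => n i)
    (Finsupp.support_nonempty_iff.mpr hf)
  have h1 := DFunLike.congr_fun h (n + ee i)
  rw [rmul_apply, shift, Finsupp.lmapDomain_apply,
    Finsupp.mapDomain_apply (add_left_injective (ee i))] at h1
  have h2 : f (n + ee i) = 0 := by
    by_contra h3
    have := hmax _ (Finsupp.mem_support_iff.mpr h3)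
    simp at this
  rw [h2, zero_mul] at h1
  exact Finsupp.mem_support_iff.mp hn h1.symm

end DA

namespace DA
open MvPolynomial
variable {k : Type} [Field k] {t : k}
variable {U : Type} [Ring U] [Algebra k U] (H : Dat k t U)

abbrev RR (k U : Type) [Field k] [Ring U] [Algebra k U] := U ⊗[k] Uᵐᵒᵖ

noncomputable def Lm (k : Type) [Field k] {U : Type} [Ring U] [Algebra k U] (u : U) : RR k U := u ⊗ₜ 1
noncomputable def Rm (k : Type) [Field k] {U : Type} [Ring U] [Algebra k U] (u : U) : RR k U := 1 ⊗ₜ MulOpposite.op u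
noncomputable def rho (k : Type) [Field k] {U : Type} [Ring U] [Algebra k U] (u : U) : RR k U := Lm k u - Rm k u

theorem Lm_mul (a b : U) : Lm k (a * b) = Lm k a * Lm k b := by simp [Lm]
theorem Rm_mul (a b : U) : Rm k (a * b) = Rm k b * Rm k a := by simp [Rm]
theorem Lm_Rm (a b : U) : Lm k a * Rm k b = Rm k b * Lm k a := by simp [Lm, Rm]
theorem Lm_add (a b : U) : Lm k (a + b) = Lm k a + Lm k b := by simp [Lm, add_tmul]
theorem Rm_add (a b : U) : Rm k (a + b) = Rm k a + Rm k b := by simp [Rm, tmul_add]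
theorem Lm_smul (c : k) (b : U) : Lm k (c • b) = c • Lm k b := by simp [Lm, smul_tmul']
theorem Rm_smul (c : k) (b : U) : Rm k (c • b) = c • Rm k b := by simp [Rm]

theorem tmul_eq (a b : U) : (a ⊗ₜ MulOpposite.op b : RR k U) = Lm k a * Rm k b := by
  simp [Lm, Rm]

theorem rho_mul (a b : U) : rho k (a * b) = Lm k a * rho k b + Rm k b * rho k a := by
  simp only [rho, Lm_mul, Rm_mul, mul_sub, Lm_Rm]; abel

noncomputable def II (i : Fin 4) : Submodule (RR k U) (RR k U) :=
  Submodule.span (RR k U) ((fun j => rho k (H.g j)) '' {j | j < i})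

theorem rho_mem_mul {I : Submodule (RR k U) (RR k U)} {a b : U} (ha : rho k a ∈ I)
    (hb : rho k b ∈ I) : rho k (a * b) ∈ I := by
  rw [rho_mul]
  exact I.add_mem (I.smul_mem _ hb) (I.smul_mem _ ha)

theorem rho_one : rho k (1 : U) = 0 := by simp [rho, Lm, Rm]

theorem rho_mem_pow {I : Submodule (RR k U) (RR k U)} {a : U} (ha : rho k a ∈ I) (n : ℕ) :
    rho k (a ^ n) ∈ I := by
  induction n with
  | zero => simp [rho_one]
  | succ n ih => rw [pow_succ]; exact rho_mem_mul ih ha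

theorem rho_gen_mem {i j : Fin 4} (h : j < i) : rho k (H.g j) ∈ II H i :=
  Submodule.subset_span ⟨j, h, rfl⟩

theorem rho_lo_mem (i : Fin 4) (m : Ix) : rho k (lo H i m) ∈ II H i := by
  fin_cases i
  · simp [lo, rho_one]
  · exact rho_mem_pow (rho_gen_mem H (by decide)) _
  · exact rho_mem_mul (rho_mem_pow (rho_gen_mem H (by decide)) _)
      (rho_mem_pow (rho_gen_mem H (by decide)) _)
  · exact rho_mem_mul (rho_mem_mul (rho_mem_pow (rho_gen_mem H (by decide)) _)
      (rho_mem_pow (rho_gen_mem H (by decide)) _)) (rho_mem_pow (rho_gen_mem H (by decide)) _)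

noncomputable def theta (i : Fin 4) : RR k U →ₗ[k] T H :=
  TensorProduct.lift (LinearMap.mk₂ k
    (fun (u : U) (w : (U)ᵐᵒᵖ) => u • kap H i (lam H w.unop))
    (fun a b c => by rw [add_smul]) (fun c a b => by rw [smul_assoc])
    (fun a b c => by rw [MulOpposite.unop_add, map_add, map_add, smul_add])
    (fun c a b => by rw [MulOpposite.unop_smul, map_smul, map_smul, smul_comm]))

theorem theta_tmul (i : Fin 4) (u w : U) :
    theta H i (u ⊗ₜ MulOpposite.op w) = u • kap H i (lam H w) := rfl

theorem R_ind {p : RR k U → Prop} (h0 : p 0) (hadd : ∀ a b, p a → p b → p (a + b))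
    (ht : ∀ u w : U, p (u ⊗ₜ MulOpposite.op w)) (r : RR k U) : p r := by
  induction r using TensorProduct.induction_on with
  | zero => exact h0
  | tmul u w => exact ht u w.unop
  | add a b ha hb => exact hadd _ _ ha hb

theorem tmul_rho (u w z : U) : (u ⊗ₜ MulOpposite.op w : RR k U) * rho k z =
    (u * z) ⊗ₜ MulOpposite.op w - u ⊗ₜ MulOpposite.op (z * w) := by
  simp [rho, Lm, Rm, mul_sub]

theorem theta_rho_lt {i j : Fin 4} (h : j < i) (r : RR k U) : theta H i (r * rho k (H.g j)) = 0 := by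
  refine R_ind (p := fun r => theta H i (r * rho k (H.g j)) = 0) (by simp) ?_ ?_ r
  · intro a b ha hb; rw [add_mul, map_add, ha, hb, add_zero]
  · intro u w
    rw [tmul_rho, map_sub, theta_tmul, theta_tmul, lam_gen_mul, kap_lt H h, mul_smul, sub_self]

theorem theta_rho_eq (i : Fin 4) (r : RR k U) : theta H i (r * rho k (H.g i)) =
    rmul H (H.g i) (theta H i r) - shift H i (theta H i r) := by
  refine R_ind (p := fun r => theta H i (r * rho k (H.g i)) =
    rmul H (H.g i) (theta H i r) - shift H i (theta H i r)) (by simp) ?_ ?_ r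
  · intro a b ha hb; rw [add_mul, map_add, ha, hb, map_add, map_add, map_add]; abel
  · intro u w
    rw [tmul_rho, map_sub, theta_tmul, theta_tmul, lam_gen_mul, mul_smul, theta_tmul, rmul_smul, shift_smul,
      ← smul_sub, ← smul_sub]
    congr 1
    rw [sub_eq_sub_iff_add_eq_add, ← kap_eq, add_comm]

theorem theta_II (i : Fin 4) (r : RR k U) (h : r ∈ II H i) : theta H i r = 0 := by
  induction h using Submodule.span_induction with
  | mem x hx =>
    obtain ⟨j, hj, rfl⟩ := hx
    simpa using theta_rho_lt H hj (1 : RR k U)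
  | zero => simp
  | add a b _ _ ha hb => rw [map_add, ha, hb, add_zero]
  | smul a x hx _ =>
    clear * - hx
    induction hx using Submodule.span_induction generalizing a with
    | mem x hx => obtain ⟨j, hj, rfl⟩ := hx; exact theta_rho_lt H hj a
    | zero => simp
    | add b c _ _ hb hc => rw [smul_add, map_add, hb, hc, add_zero]
    | smul b x _ ih => rw [smul_smul]; exact ih _

noncomputable def sig : T H →ₗ[k] RR k U :=
  Finsupp.lsum k (fun n => (TensorProduct.mk k _ _).flip (MulOpposite.op (pbw H n)))

theorem sig_single (n : Ix) (u : U) :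
    sig H (Finsupp.single n u) = u ⊗ₜ MulOpposite.op (pbw H n) := by
  simp [sig]

theorem sub_sig (i : Fin 4) (r : RR k U) : sig H (theta H i r) - r ∈ II H i := by
  refine R_ind (p := fun r => sig H (theta H i r) - r ∈ II H i) (by simp) ?_ ?_ r
  · intro a b ha hb
    rw [map_add, map_add, add_sub_add_comm]
    exact add_mem ha hb
  · intro u w
    rw [theta_tmul]
    suffices h : ∀ v : V k, sig H (u • kap H i v) - u ⊗ₜ MulOpposite.op (mon H v) ∈ II H i by
      simpa only [mon_lam] using h (lam H w)
    intro v
    induction v using MvPolynomial.induction_on' with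
    | add p q hp hq =>
      rw [map_add, smul_add, map_add, map_add, MulOpposite.op_add, tmul_add, add_sub_add_comm]
      exact add_mem hp hq
    | monomial m a =>
      have hm : monomial m a = a • mo k m := by simp [smul_monomial]
      have h := (II H i).smul_mem (u ⊗ₜ MulOpposite.op (pbw H (hi i m)) : RR k U)
        (rho_lo_mem H i m)
      rw [smul_eq_mul, tmul_rho, lo_mul_hi] at h
      rw [hm, (kap H i).map_smul, (mon H).map_smul, smul_comm u a, (sig H).map_smul, MulOpposite.op_smul, tmul_smul, ← smul_sub,
        kap_mo, mon_mo, Finsupp.smul_single, sig_single]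
      exact Submodule.smul_of_tower_mem _ a h

theorem Skey (i : Fin 4) (r : RR k U) (h : r * rho k (H.g i) ∈ II H i) : r ∈ II H i := by
  have h1 := theta_II H i _ h
  rw [theta_rho_eq, sub_eq_zero] at h1
  have h2 := sub_sig H i r
  rw [Phi_inj H i _ h1, map_zero, zero_sub] at h2
  simpa using h2


theorem S0' (r : RR k U) (h : r * rho k (H.g 0) = 0) : r = 0 := by
  have := Skey H 0 r (by rw [h]; exact zero_mem _)
  simpa [II] using this

theorem II1 (r : RR k U) : r ∈ II H 1 ↔ ∃ a, a * rho k (H.g 0) = r := by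
  have : {j : Fin 4 | j < 1} = {0} := by ext j; simp
  rw [II, this, Set.image_singleton, Submodule.mem_span_singleton]; rfl

theorem II2 (r : RR k U) : r ∈ II H 2 ↔ ∃ a b, a * rho k (H.g 0) + b * rho k (H.g 1) = r := by
  have : {j : Fin 4 | j < 2} = {0, 1} := by
    ext j; simp only [Set.mem_setOf_eq, Set.mem_insert_iff, Set.mem_singleton_iff]; revert j; decide
  rw [II, this, Set.image_pair, Submodule.mem_span_pair]; rfl

theorem II3 (r : RR k U) : r ∈ II H 3 ↔
    ∃ a b c, a * rho k (H.g 0) + b * rho k (H.g 1) + c * rho k (H.g 2) = r := by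
  have : {j : Fin 4 | j < 3} = {0, 1, 2} := by
    ext j; simp only [Set.mem_setOf_eq, Set.mem_insert_iff, Set.mem_singleton_iff]; revert j; decide
  rw [II, this, Set.image_insert_eq, Set.image_pair, Submodule.mem_span_triple]; rfl

theorem L_of {a b c d : U} (h : a * b = c * d) : Lm k a * Lm k b = Lm k c * Lm k d := by
  rw [← Lm_mul, h, Lm_mul]
theorem R_of {a b c d : U} (h : a * b = c * d) : Rm k b * Rm k a = Rm k d * Rm k c := by
  rw [← Rm_mul, h, Rm_mul]
theorem LE_of {a b : U} (h : a * b = b * a + b) :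
    Lm k a * Lm k b = Lm k b * Lm k a + Lm k b := by
  rw [← Lm_mul, h, Lm_add, Lm_mul]
theorem RE_of {a b : U} (h : a * b = b * a + b) :
    Rm k b * Rm k a = Rm k a * Rm k b + Rm k b := by
  rw [← Rm_mul, h, Rm_add, Rm_mul]
theorem L_Dy : Lm k (H.g 2) * Lm k (H.g 1) = Lm k (H.g 1) * Lm k (H.g 2) +
    (Lm k (H.g 1) * Lm k (H.g 1) + t • (Lm k (H.g 0) * Lm k (H.g 1))) := by
  rw [← Lm_mul, H.Dy]; simp only [Lm_add, Lm_mul, Lm_smul]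
theorem R_Dy : Rm k (H.g 1) * Rm k (H.g 2) = Rm k (H.g 2) * Rm k (H.g 1) +
    (Rm k (H.g 1) * Rm k (H.g 1) + t • (Rm k (H.g 1) * Rm k (H.g 0))) := by
  rw [← Rm_mul, H.Dy]; simp only [Rm_add, Rm_mul, Rm_smul]

noncomputable def KD : KData (RR k U) where
  X := rho k (H.g 0)
  Y := rho k (H.g 1)
  D := rho k (H.g 2)
  E := rho k (H.g 3)
  A := Lm k (H.g 1) + Rm k (H.g 1) + t • Lm k (H.g 0)
  B := t • Rm k (H.g 1)
  XY := by
    simp only [rho, mul_sub, sub_mul, ← Lm_Rm, L_of H.yx, R_of H.yx]; abel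
  XD := by
    simp only [rho, mul_sub, sub_mul, ← Lm_Rm, L_of H.Dx, R_of H.Dx]; abel
  YD := by
    simp only [rho, mul_sub, sub_mul, ← Lm_Rm, L_Dy, R_Dy, add_mul, smul_mul_assoc, smul_add,
      smul_sub]
    abel
  EX := by
    simp only [rho, mul_sub, sub_mul, ← Lm_Rm, LE_of H.Ex, RE_of H.Ex]; abel
  EY := by
    simp only [rho, mul_sub, sub_mul, ← Lm_Rm, LE_of H.Ey, RE_of H.Ey]; abel
  ED := by
    simp only [rho, mul_sub, sub_mul, ← Lm_Rm, LE_of H.ED, RE_of H.ED]; abel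
  EA := by
    simp only [rho, mul_sub, sub_mul, mul_add, add_mul, ← Lm_Rm, LE_of H.Ey, RE_of H.Ey,
      LE_of H.Ex, mul_smul_comm, smul_mul_assoc, smul_add, smul_sub]; abel
  EB := by
    simp only [rho, mul_sub, sub_mul, mul_add, add_mul, ← Lm_Rm, RE_of H.Ey,
      mul_smul_comm, smul_mul_assoc, smul_add, smul_sub]; abel
  AX := by
    simp only [rho, mul_sub, sub_mul, mul_add, add_mul, ← Lm_Rm, L_of H.yx, R_of H.yx,
      mul_smul_comm, smul_mul_assoc, smul_add, smul_sub]; abel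
  AY := by
    simp only [rho, mul_sub, sub_mul, mul_add, add_mul, ← Lm_Rm, L_of H.yx, R_of H.yx,
      mul_smul_comm, smul_mul_assoc, smul_add, smul_sub]; abel
  BX := by
    simp only [rho, mul_sub, sub_mul, mul_add, add_mul, ← Lm_Rm, L_of H.yx, R_of H.yx,
      mul_smul_comm, smul_mul_assoc, smul_add, smul_sub]
  BY := by
    simp only [rho, mul_sub, sub_mul, mul_add, add_mul, ← Lm_Rm,
      mul_smul_comm, smul_mul_assoc, smul_add, smul_sub]
  S0 := S0' H
  S1 r a h := by
    obtain ⟨b, hb⟩ := (II1 H r).1 (Skey H 1 r ((II1 H _).2 ⟨a, h.symm⟩))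
    exact ⟨b, hb.symm⟩
  S2 r a b h := by
    obtain ⟨a', b', hb⟩ := (II2 H r).1 (Skey H 2 r ((II2 H _).2 ⟨a, b, h.symm⟩))
    exact ⟨a', b', hb.symm⟩
  S3 r a b c h := by
    obtain ⟨a', b', c', hb⟩ := (II3 H r).1 (Skey H 3 r ((II3 H _).2 ⟨a, b, c, h.symm⟩))
    exact ⟨a', b', c', hb.symm⟩

noncomputable def eps (k : Type) [Field k] (U : Type) [Ring U] [Algebra k U] :
    RR k U →ₗ[RR k U] U :=
  LinearMap.toSpanSingleton (RR k U) U 1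

theorem tmul_act (a b u : U) : (a ⊗ₜ MulOpposite.op b : RR k U) • u = a * u * b := by
  rw [TensorProduct.Algebra.smul_def, MulOpposite.smul_eq_mul_unop, smul_eq_mul, mul_assoc]; rfl

theorem Lm_act (a u : U) : Lm k a • u = a * u := by
  have := tmul_act (k := k) a 1 u
  simpa [Lm] using this
theorem Rm_act (a u : U) : Rm k a • u = u * a := by
  have := tmul_act (k := k) 1 a u
  simpa [Rm] using this
theorem rho_act (a u : U) : rho k a • u = a * u - u * a := by
  rw [rho, sub_smul, Lm_act, Rm_act]

theorem k_act (c : k) (u : U) : (algebraMap k (RR k U) c) • u = c • u := by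
  have := Lm_act (k := k) (algebraMap k U c) u
  rw [Algebra.smul_def, ← this]; rfl
theorem smul_act (c : k) (r : RR k U) (u : U) : (c • r) • u = c • (r • u) := by
  rw [Algebra.smul_def c r, mul_smul, k_act]

theorem eps_surj : Function.Surjective (eps k U) := fun u => ⟨Lm k u, by
  rw [eps, LinearMap.toSpanSingleton_apply, Lm_act, mul_one]⟩

theorem rho_mem_range (u : U) : rho k u ∈ (KD H).I4 := by
  refine H.induct (fun u => rho k u ∈ (KD H).I4) ?_ ?_ ?_ ?_ u
  · rw [rho_one]; exact zero_mem _
  · intro a b ha hb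
    have : rho k (a + b) = rho k a + rho k b := by simp only [rho, Lm_add, Rm_add]; abel
    rw [this]; exact add_mem ha hb
  · intro c a ha
    have : rho k (c • a) = c • rho k a := by simp only [rho, Lm_smul, Rm_smul, smul_sub]
    rw [this]; exact Submodule.smul_of_tower_mem _ c ha
  · intro i a ha
    refine rho_mem_mul ?_ ha
    fin_cases i
    · exact (KD H).X_mem
    · exact (KD H).Y_mem
    · exact (KD H).D_mem
    · exact (KD H).E_mem

theorem sub_eps_mem (r : RR k U) : r - Lm k (eps k U r) ∈ (KD H).I4 := by
  refine R_ind (p := fun r => r - Lm k (eps k U r) ∈ (KD H).I4) ?_ ?_ ?_ r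
  · simp [Lm]
  · intro a b ha hb
    rw [map_add, Lm_add, add_sub_add_comm]; exact add_mem ha hb
  · intro u w
    rw [eps, LinearMap.toSpanSingleton_apply, tmul_act, mul_one, tmul_eq, Lm_mul, ← mul_sub,
      ← neg_sub]
    exact Submodule.smul_mem _ (Lm k u) (neg_mem (rho_mem_range H w))

theorem mem_of_eps (r : RR k U) (h : eps k U r = 0) : r ∈ (KD H).I4 := by
  have := sub_eps_mem H r
  rw [h] at this
  simpa [Lm] using this

theorem eps_rho (a : U) : eps k U (rho k a) = 0 := by
  rw [eps, LinearMap.toSpanSingleton_apply, rho_act]; simp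

end DA

namespace DA
open MvPolynomial
variable {k : Type} [Field k] {t : k}
variable {U : Type} [Ring U] [Algebra k U] (H : Dat k t U)

/-- Shift of the last variable. -/
noncomputable def sh : V k →ₐ[k] V k := aeval ![X 0, X 1, X 2, X 3 + 1]

theorem sh0 : sh (X 0 : V k) = X 0 := by simp [sh]
theorem sh1 : sh (X 1 : V k) = X 1 := by simp [sh]
theorem sh2 : sh (X 2 : V k) = X 2 := by simp [sh]
theorem sh3 : sh (X 3 : V k) = X 3 + 1 := by simp [sh]
theorem shC (c : k) : sh (C c : V k) = C c := by simp [sh]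

theorem pderiv_sh (i : Fin 4) (v : V k) : pderiv i (sh v) = sh (pderiv i v) := by
  induction v using MvPolynomial.induction_on with
  | C a => simp [shC]
  | add p q hp hq => simp [hp, hq]
  | mul_X p j hp =>
    rw [map_mul, Derivation.leibniz, Derivation.leibniz, hp]
    have : pderiv i (sh (X j : V k)) = sh (pderiv i (X j)) := by
      fin_cases j <;> fin_cases i <;>
        simp [sh0, sh1, sh2, sh3, pderiv_X, Pi.single_apply]
    rw [this]; simp

noncomputable def e0 (v : V k) : k := constantCoeff v
noncomputable def e1 (i : Fin 4) (v : V k) : k := constantCoeff (pderiv i v)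
noncomputable def e2 (i j : Fin 4) (v : V k) : k := constantCoeff (pderiv i (pderiv j v))

theorem pX (i j : Fin 4) : pderiv i (X j : V k) = if i = j then 1 else 0 := by
  rw [pderiv_X, Pi.single_apply]
  by_cases h : i = j <;> simp [h, eq_comm]

theorem lam_mul_x (u : U) : lam H (u * H.g 0) = X 0 * sh (lam H u) := by
  refine H.induct (fun u => lam H (u * H.g 0) = X 0 * sh (lam H u)) ?_ ?_ ?_ ?_ u
  · have := lam_gen_mul H 0 1
    simpa [lam_one, op0] using this
  · intro a b ha hb; rw [add_mul, map_add, ha, hb, map_add, map_add, mul_add]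
  · intro c a ha; rw [smul_mul_assoc, map_smul, ha, map_smul, map_smul, mul_smul_comm]
  · intro i a ha
    rw [mul_assoc, lam_gen_mul, ha, lam_gen_mul]
    generalize lam H a = v
    fin_cases i <;> simp [op0, op1, op2, op3, sh0, sh1, sh2, sh3, shC, pX, pderiv_sh] <;> ring

theorem lam_mul_D (u : U) : lam H (u * H.g 2) = X 2 * sh (lam H u) := by
  refine H.induct (fun u => lam H (u * H.g 2) = X 2 * sh (lam H u)) ?_ ?_ ?_ ?_ u
  · have := lam_gen_mul H 2 1
    simpa [lam_one, op2] using this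
  · intro a b ha hb; rw [add_mul, map_add, ha, hb, map_add, map_add, mul_add]
  · intro c a ha; rw [smul_mul_assoc, map_smul, ha, map_smul, map_smul, mul_smul_comm]
  · intro i a ha
    rw [mul_assoc, lam_gen_mul, ha, lam_gen_mul]
    generalize lam H a = v
    fin_cases i <;> simp [op0, op1, op2, op3, sh0, sh1, sh2, sh3, shC, pX, pderiv_sh] <;> ring

theorem lam_mul_E (u : U) : lam H (u * H.g 3) = X 3 * lam H u := by
  refine H.induct (fun u => lam H (u * H.g 3) = X 3 * lam H u) ?_ ?_ ?_ ?_ u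
  · have := lam_gen_mul H 3 1
    simpa [lam_one, op3] using this
  · intro a b ha hb; rw [add_mul, map_add, ha, hb, map_add, mul_add]
  · intro c a ha; rw [smul_mul_assoc, map_smul, ha, map_smul, mul_smul_comm]
  · intro i a ha
    rw [mul_assoc, lam_gen_mul, ha, lam_gen_mul]
    generalize lam H a = v
    fin_cases i <;> simp [op0, op1, op2, op3, pX] <;> ring

/-- The low order terms of `q` are those of right multiplication by `y`. -/
def Py (t : k) (q s : V k) : Prop :=
  e0 q = 0 ∧ e1 0 q = 0 ∧ e1 1 q = e0 s ∧ e1 2 q = 0 ∧ e2 0 0 q = 0 ∧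
    e2 0 1 q = e1 0 s + t * e1 2 s ∧ e2 0 2 q = 0 ∧ e2 1 1 q = 2 * (e1 1 s + e1 2 s) ∧
    e2 1 2 q = e1 2 s ∧ e2 2 2 q = 0

theorem lam_mul_y (u : U) : Py t (lam H (u * H.g 1)) (sh (lam H u)) := by
  refine H.induct (fun u => Py t (lam H (u * H.g 1)) (sh (lam H u))) ?_ ?_ ?_ ?_ u
  · have : lam H (H.g 1) = X 1 := by simpa [lam_one, op1] using lam_gen_mul H 1 1
    simp [lam_one, this, pX, Py, e0, e1, e2]
  · rintro a b ⟨h1, h2, h3, h4, h5, h6, h7, h8, h9, h10⟩ ⟨k1, k2, k3, k4, k5, k6, k7, k8, k9, k10⟩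
    simp only [Py, e0, e1, e2] at *
    simp only [add_mul, map_add, h1, h2, h3, h4, h5, h6, h7, h8, h9, h10, k1, k2, k3, k4, k5, k6,
      k7, k8, k9, k10, add_zero, true_and, and_true]
    refine ⟨?_, ?_⟩ <;> ring
  · rintro c a ⟨h1, h2, h3, h4, h5, h6, h7, h8, h9, h10⟩
    simp only [Py, e0, e1, e2] at *
    simp only [smul_mul_assoc, map_smul, Derivation.map_smul, constantCoeff_smul, smul_eq_mul, h1, h2, h3, h4, h5, h6, h7,
      h8, h9, h10, mul_zero, true_and, and_true]
    refine ⟨?_, ?_⟩ <;> ring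
  · rintro i a ⟨h1, h2, h3, h4, h5, h6, h7, h8, h9, h10⟩
    simp only [Py, e0, e1, e2] at *
    simp only [mul_assoc, lam_gen_mul]
    generalize lam H (a * H.g 1) = q at *
    generalize lam H a = v at *
    have p10 := pcomm 1 0 q
    have p20 := pcomm 2 0 q
    have p21 := pcomm 2 1 q
    fin_cases i <;>
      simp [op0, op1, op2, op3, sh0, sh1, sh2, sh3, shC, pX, p10, p20, p21, h1, h2, h3, h4, h5, h6,
        h7, h8, h9, h10, ← pderiv_sh] <;> (try (refine ⟨?_, ?_⟩)) <;> ring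

end DA

namespace DA
open MvPolynomial
variable {k : Type} [Field k] {t : k}
variable {U : Type} [Ring U] [Algebra k U] (H : Dat k t U)

/-- The cocycle expression. -/
def coc (a b c : U) : U :=
  (H.g 0 * b - b * H.g 0) - (H.g 1 * a - a * H.g 1) +
    ((H.g 2 * c - c * H.g 2) - (H.g 1 * c + c * H.g 1 + t • (H.g 0 * c)))

theorem yx' (z : U) : H.g 1 * (H.g 0 * z) = H.g 0 * (H.g 1 * z) := by
  rw [← mul_assoc, H.yx, mul_assoc]
theorem Dx' (z : U) : H.g 2 * (H.g 0 * z) = H.g 0 * (H.g 2 * z) := by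
  rw [← mul_assoc, H.Dx, mul_assoc]
theorem Dy' (z : U) : H.g 2 * (H.g 1 * z) =
    H.g 1 * (H.g 2 * z) + (H.g 1 * (H.g 1 * z) + t • (H.g 0 * (H.g 1 * z))) := by
  rw [← mul_assoc, H.Dy]; simp only [add_mul, mul_assoc, smul_mul_assoc]
theorem Ex' (z : U) : H.g 3 * (H.g 0 * z) = H.g 0 * (H.g 3 * z) + H.g 0 * z := by
  rw [← mul_assoc, H.Ex, add_mul, mul_assoc]
theorem Ey' (z : U) : H.g 3 * (H.g 1 * z) = H.g 1 * (H.g 3 * z) + H.g 1 * z := by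
  rw [← mul_assoc, H.Ey, add_mul, mul_assoc]
theorem ED' (z : U) : H.g 3 * (H.g 2 * z) = H.g 2 * (H.g 3 * z) + H.g 2 * z := by
  rw [← mul_assoc, H.ED, add_mul, mul_assoc]

def c1 : U := (3 : k) • (H.g 2 * H.g 2)
def a1 : U := (6 : k) • (H.g 2 * (H.g 2 * H.g 3)) - (6 : k) • (H.g 1 * (H.g 2 * (H.g 3 * H.g 3))) +
  ((2 : k) • (H.g 1 * (H.g 1 * (H.g 3 * (H.g 3 * H.g 3)))) -
    (3 : k) • (H.g 1 * (H.g 1 * (H.g 3 * H.g 3))) + H.g 1 * (H.g 1 * H.g 3))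
def b1 : U := (6 * t) • (H.g 1 * (H.g 2 * (H.g 3 * H.g 3))) - (3 * t) • (H.g 2 * (H.g 2 * H.g 3)) +
  (3 * t ^ 2) • (H.g 0 * (H.g 1 * (H.g 3 * H.g 3))) -
  t • ((2 : k) • (H.g 1 * (H.g 1 * (H.g 3 * (H.g 3 * H.g 3)))) -
    (3 : k) • (H.g 1 * (H.g 1 * (H.g 3 * H.g 3))) + H.g 1 * (H.g 1 * H.g 3)) +
  (3 * t) • (H.g 1 * (H.g 1 * (H.g 3 * H.g 3)))
def b2 : U := H.g 2 * H.g 2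
def b3 : U := H.g 0 * H.g 2
def a4 : U := H.g 2 * H.g 2 - (2 : k) • (H.g 1 * (H.g 2 * H.g 3)) +
  (H.g 1 * (H.g 1 * (H.g 3 * H.g 3)) - H.g 1 * (H.g 1 * H.g 3))
def b4 : U := (2 * t) • (H.g 1 * (H.g 2 * H.g 3)) + (t ^ 2) • (H.g 0 * (H.g 1 * H.g 3)) -
  t • (H.g 1 * (H.g 1 * (H.g 3 * H.g 3))) + (2 * t) • (H.g 1 * (H.g 1 * H.g 3))

theorem coc1 : coc H (a1 H) (b1 H) (c1 H) = 0 := by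
  simp only [coc, a1, b1, c1, mul_assoc, mul_add, add_mul, mul_sub, sub_mul, smul_mul_assoc,
    mul_smul_comm, yx', Dx', Dy', Ex', Ey', ED', H.yx, H.Dx, H.Dy, H.Ex, H.Ey, H.ED]
  module
theorem coc2 : coc H 0 (b2 H) 0 = 0 := by
  simp only [coc, b2, mul_assoc, mul_zero, zero_mul, smul_zero, Dx', H.Dx]; simp
theorem coc3 : coc H 0 (b3 H) 0 = 0 := by
  simp only [coc, b3, mul_assoc, mul_zero, zero_mul, smul_zero, Dx', H.Dx]; simp
theorem coc4 : coc H (a4 H) (b4 H) 0 = 0 := by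
  simp only [coc, a4, b4, mul_assoc, mul_add, add_mul, mul_sub, sub_mul, smul_mul_assoc,
    mul_smul_comm, yx', Dx', Dy', Ex', Ey', ED', H.yx, H.Dx, H.Dy, H.Ex, H.Ey, H.ED, mul_zero, zero_mul]
  module
end DA

namespace DA
open MvPolynomial
variable {k : Type} [Field k] {t : k}
variable {U : Type} [Ring U] [Algebra k U] (H : Dat k t U)

/-- Second order coefficient functional. -/
noncomputable def e2l (i j : Fin 4) : U →ₗ[k] k where
  toFun u := e2 i j (lam H u)
  map_add' u v := by simp [e2]
  map_smul' u v := by simp [e2]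

theorem e2l_apply (i j : Fin 4) (u : U) :
    e2l H i j u = constantCoeff (pderiv i (pderiv j (lam H u))) := rfl

theorem e2l_E (i j : Fin 4) (hi : i ≠ 3) (hj : j ≠ 3) (g : U) :
    e2l H i j (H.g 3 * g - g * H.g 3 - (g + g)) = 0 := by
  rw [e2l_apply]
  simp only [map_sub, map_add, lam_gen_mul, lam_mul_E, op3]
  generalize lam H g = v
  have p10 := pcomm 1 0 v
  have p20 := pcomm 2 0 v
  have p21 := pcomm 2 1 v
  fin_cases i <;> fin_cases j <;> first | exact absurd rfl hi | exact absurd rfl hj | skip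
  all_goals simp [pX, p10, p20, p21]

/-- Coboundaries. -/
def cobC (qx qy : U) : U := (H.g 0 * qy - qy * H.g 0) - (H.g 1 * qx - qx * H.g 1)
def cobA (qx p : U) : U := (H.g 0 * p - p * H.g 0) - (H.g 2 * qx - qx * H.g 2)
def cobB (qx qy p : U) : U := (H.g 1 * p - p * H.g 1) +
  ((H.g 1 * qy + qy * H.g 1 + t • (H.g 0 * qy)) - (H.g 2 * qy - qy * H.g 2)) + t • (qx * H.g 1)

theorem det [CharZero k] (ht : t ≠ 0) (qx qy p : U) :
    e2l H 2 2 (cobC H qx qy) = 0 ∧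
    e2l H 2 2 (cobB H qx qy p) + 2 * e2l H 0 2 (cobC H qx qy) = 0 ∧
    e2l H 2 2 (cobA H qx p) - 2 * e2l H 1 2 (cobC H qx qy) = 0 ∧
    2 * t * (e2l H 1 2 (cobB H qx qy p) - e2l H 0 2 (cobA H qx p) + e2l H 0 1 (cobC H qx qy))
      - 2 * (2 * e2l H 0 2 (cobB H qx qy p) + e2l H 0 0 (cobC H qx qy))
      - t * e2l H 2 2 (cobB H qx qy p)
      - 2 * t ^ 2 * (e2l H 1 1 (cobC H qx qy) - 2 * e2l H 1 2 (cobA H qx p)) = 0 := by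
  have hx := lam_mul_y H qx
  have hy := lam_mul_y H qy
  have hp := lam_mul_y H p
  simp only [e2l_apply, cobA, cobB, cobC, map_sub, map_add, map_smul, lam_gen_mul, lam_mul_x, lam_mul_D, op0, op1, op2]
  generalize lam H (qx * H.g 1) = rx at *
  generalize lam H (qy * H.g 1) = ry at *
  generalize lam H (p * H.g 1) = rp at *
  generalize lam H qx = vx at *
  generalize lam H qy = vy at *
  generalize lam H p = vp at *
  simp only [Py, e0, e1, e2] at *
  obtain ⟨h1, h2, h3, h4, h5, h6, h7, h8, h9, h10⟩ := hx
  obtain ⟨k1, k2, k3, k4, k5, k6, k7, k8, k9, k10⟩ := hy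
  obtain ⟨l1, l2, l3, l4, l5, l6, l7, l8, l9, l10⟩ := hp
  simp [pX, h1, h2, h3, h4, h5, h6, h7, h8, h9, h10, k1, k2, k3, k4, k5, k6, k7, k8, k9, k10,
    l1, l2, l3, l4, l5, l6, l7, l8, l9, l10]
  refine ⟨?_, ?_, ?_⟩ <;> ring
end DA

namespace DA
open MvPolynomial
variable {k : Type} [Field k] {t : k}
variable {U : Type} [Ring U] [Algebra k U] (H : Dat k t U)

theorem e2l_val (i j : Fin 4) (hi : i ≠ 3) (hj : j ≠ 3) :
    e2l H i j (a1 H) = 0 ∧ e2l H i j (b1 H) = 0 ∧ e2l H i j (b4 H) = 0 ∧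
    e2l H i j (c1 H) = (if i = 2 ∧ j = 2 then 6 else 0) ∧
    e2l H i j (b2 H) = (if i = 2 ∧ j = 2 then 2 else 0) ∧
    e2l H i j (a4 H) = (if i = 2 ∧ j = 2 then 2 else 0) ∧
    e2l H i j (b3 H) = (if i = 0 ∧ j = 2 ∨ i = 2 ∧ j = 0 then 1 else 0) := by
  have h3 : lam H (H.g 3) = X 3 := by simpa [lam_one, op3] using lam_gen_mul H 3 1
  have h2 : lam H (H.g 2) = X 2 := by simpa [lam_one, op2] using lam_gen_mul H 2 1
  simp only [a1, b1, c1, b2, b3, a4, b4, e2l_apply, map_add, map_sub, map_smul, lam_gen_mul, h3, h2,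
    op0, op1, op2, op3]
  fin_cases i <;> fin_cases j <;> first | exact absurd rfl hi | exact absurd rfl hj | skip
  all_goals simp [pX]
  all_goals norm_num

theorem rank_main {k : Type} [Field k] {t : k} {U : Type} [Ring U] [Algebra k U] (H : Dat k t U)
    [CharZero k] (ht : t ≠ 0) : 4 ≤ Module.rank k (HH k U 3) := by
  unfold HH
  refine (KD H).rank_ge (eps k U) eps_surj (mem_of_eps H) (eps_rho _) (eps_rho _) (eps_rho _)
    (eps_rho _) ![c1 H, 0, 0, 0] ![a1 H, 0, 0, a4 H] ![b1 H, b2 H, b3 H, b4 H] ?_ ?_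
  · have key : ∀ a b c : U, (KD H).X • b - (KD H).Y • a + ((KD H).D - (KD H).A) • c
        = coc H a b c := by
      intro a b c
      simp only [KD, coc, sub_smul, add_smul, smul_act, rho_act, Lm_act, Rm_act]
    intro i
    rw [key]
    fin_cases i
    · exact coc1 H
    · exact coc2 H
    · exact coc3 H
    · exact coc4 H
  · intro e gxy gxD gyD qx qy p hc ha hb
    have kC : (KD H).X • qy - (KD H).Y • qx = cobC H qx qy := by
      simp only [KD, cobC, rho_act]
    have kA : (KD H).X • p - (KD H).D • qx = cobA H qx p := by
      simp only [KD, cobA, rho_act]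
    have kB : (KD H).Y • p + ((KD H).A - (KD H).D) • qy + (KD H).B • qx = cobB H qx qy p := by
      simp only [KD, cobB, sub_smul, add_smul, smul_act, rho_act, Lm_act, Rm_act]
    have kE : ∀ g : U, ((KD H).E - 2) • g = H.g 3 * g - g * H.g 3 - (g + g) := by
      intro g
      rw [sub_smul, ofNat_smul_eq_nsmul, two_nsmul]
      simp only [KD, rho_act]
    rw [kC, kE] at hc
    rw [kA, kE] at ha
    rw [kB, kE] at hb
    simp only [Fin.sum_univ_four, k_act] at hc ha hb
    change e 0 • c1 H + e 1 • (0 : U) + e 2 • (0 : U) + e 3 • (0 : U) = _ at hc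
    change e 0 • a1 H + e 1 • (0 : U) + e 2 • (0 : U) + e 3 • a4 H = _ at ha
    change e 0 • b1 H + e 1 • b2 H + e 2 • b3 H + e 3 • b4 H = _ at hb
    have HC : ∀ i j, i ≠ 3 → j ≠ 3 → e2l H i j (cobC H qx qy) = e 0 * e2l H i j (c1 H) := by
      intro i j hi hj
      have h := congrArg (e2l H i j) hc
      rw [map_add _ (cobC H qx qy), e2l_E H i j hi hj, add_zero] at h
      rw [← h]; simp
    have HA : ∀ i j, i ≠ 3 → j ≠ 3 → e2l H i j (cobA H qx p) = e 3 * e2l H i j (a4 H) := by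
      intro i j hi hj
      have h := congrArg (e2l H i j) ha
      rw [map_add _ (cobA H qx p), e2l_E H i j hi hj, add_zero] at h
      rw [← h]; simp [(e2l_val H i j hi hj).1]
    have HB : ∀ i j, i ≠ 3 → j ≠ 3 → e2l H i j (cobB H qx qy p) =
        e 1 * e2l H i j (b2 H) + e 2 * e2l H i j (b3 H) := by
      intro i j hi hj
      have h := congrArg (e2l H i j) hb
      rw [map_add _ (cobB H qx qy p), e2l_E H i j hi hj, add_zero] at h
      rw [← h]; simp [(e2l_val H i j hi hj).2.1, (e2l_val H i j hi hj).2.2.1]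
    obtain ⟨d1, d2, d3, d4⟩ := det H ht qx qy p
    have n0 : (0 : Fin 4) ≠ 3 := by decide
    have n1 : (1 : Fin 4) ≠ 3 := by decide
    have n2 : (2 : Fin 4) ≠ 3 := by decide
    obtain ⟨-, -, -, v1, v2, v3, v4⟩ := e2l_val H 2 2 n2 n2
    obtain ⟨-, -, -, w1, w2, w3, w4⟩ := e2l_val H 0 2 n0 n2
    obtain ⟨-, -, -, x1, x2, x3, x4⟩ := e2l_val H 1 2 n1 n2
    obtain ⟨-, -, -, y1, y2, y3, y4⟩ := e2l_val H 0 0 n0 n0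
    obtain ⟨-, -, -, z1, z2, z3, z4⟩ := e2l_val H 0 1 n0 n1
    obtain ⟨-, -, -, u1, u2, u3, u4⟩ := e2l_val H 1 1 n1 n1
    simp only [HC _ _ n2 n2, HC _ _ n0 n2, HC _ _ n1 n2, HC _ _ n0 n0, HC _ _ n0 n1, HC _ _ n1 n1,
      HA _ _ n2 n2, HA _ _ n0 n2, HA _ _ n1 n2, HB _ _ n2 n2, HB _ _ n0 n2, HB _ _ n1 n2,
      v1, v2, v3, v4, w1, w2, w3, w4, x1, x2, x3, x4, y1, y2, y3, y4, z1, z2, z3, z4,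
      u1, u2, u3, u4] at d1 d2 d3 d4
    simp at d1
    simp [d1] at d2 d3
    simp [d1, d2, d3] at d4
    funext i
    fin_cases i
    · exact d1
    · exact d2
    · exact d4
    · exact d3
end DA


/-- `HH³(Diff 𝒜)` has dimension at least `4` over `k`. -/
theorem HH3_DiffA_dim_ge_four (k : Type) [Field k] [CharZero k] (t : k) (ht : t ≠ 0) :
    4 ≤ Module.rank k (HH k (DiffA k t) 3) := by
  exact DA.rank_main (DA.dat t) ht
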